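/- Let (Ω, 𝓕, ℙ) be a probability space, Y : Ω → {0,1} a random variable with 0 < ℙ(Y=0) < 1, and X₁, X₂ : Ω → [0,1] random variables that are each calibrated for Y. Then X₁ is sharper than X₂ (i.e., E[φ(X₁)] ≥ E[φ(X₂)] for every convex function φ : [0,1] → ℝ, with strict inequality for some convex φ) if and only if X₁ dominates X₂ in the Murphy sense (i.e., E[S_θ(X₁,Y)] ≤ E[S_θ(X₂,Y)] for all θ ∈ (0,1), with strict inequality for some θ). -/

import Mathlib

open MeasureTheory

/-- The elementary scoring rule `S_θ(x,y)` for a probability forecast `x ∈ [0,1]`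
and binary outcome `y ∈ {0,1}`. -/
noncomputable def elemScore (θ x y : ℝ) : ℝ :=
  2 * θ * (if θ < x ∧ y = 0 then 1 else 0)
    + 2 * (1 - θ) * (if x < θ ∧ y = 1 then 1 else 0)
    + 2 * θ * (1 - θ) * (if x = θ then 1 else 0)

lemma aux_cal {Ω : Type*} [mΩ : MeasurableSpace Ω] (μ : Measure Ω) [IsProbabilityMeasure μ]
    (X Y : Ω → ℝ) (hX : Measurable X) (hY : Integrable Y μ) (hXi : Integrable X μ)
    (hcal : μ[Y | MeasurableSpace.comap X inferInstance] =ᵐ[μ] X)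
    (B : Set ℝ) (hB : MeasurableSet B) :
    ∫ ω, (X ⁻¹' B).indicator (fun ω => Y ω - X ω) ω ∂μ = 0 := by
  have hm : MeasurableSpace.comap X inferInstance ≤ mΩ := hX.comap_le
  rw [integral_indicator (hX hB), integral_sub hY.integrableOn hXi.integrableOn]
  have h1 := setIntegral_condExp (μ := μ) hm hY (s := X ⁻¹' B) ⟨B, hB, rfl⟩
  rw [← h1, sub_eq_zero]
  exact integral_congr_ae (ae_restrict_of_ae hcal)

lemma aux_int {Ω : Type*} [MeasurableSpace Ω] (μ : Measure Ω) [IsProbabilityMeasure μ]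
    (X : Ω → ℝ) (hX : Measurable X) (hXr : ∀ ω, X ω ∈ Set.Icc (0:ℝ) 1) : Integrable X μ :=
  Integrable.of_bound hX.aestronglyMeasurable 1
    (Filter.Eventually.of_forall fun ω => by
      rw [Real.norm_eq_abs, abs_le]; constructor <;> linarith [(hXr ω).1, (hXr ω).2])

lemma aux_score {Ω : Type*} [MeasurableSpace Ω] (μ : Measure Ω) [IsProbabilityMeasure μ]
    (X Y : Ω → ℝ) (hX : Measurable X) (hY : Measurable Y)
    (hXr : ∀ ω, X ω ∈ Set.Icc (0:ℝ) 1) (hYr : ∀ ω, Y ω = 0 ∨ Y ω = 1)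
    (hcal : μ[Y | MeasurableSpace.comap X inferInstance] =ᵐ[μ] X) (θ : ℝ) :
    ∫ ω, elemScore θ (X ω) (Y ω) ∂μ
      = 2 * (1 - θ) * ∫ ω, X ω ∂μ - 2 * ∫ ω, max (X ω - θ) 0 ∂μ := by
  have hXi := aux_int μ X hX hXr
  have hYi := aux_int μ Y hY (fun ω => by rcases hYr ω with h | h <;> simp [h])
  have hM : Integrable (fun ω => max (X ω - θ) 0) μ :=
    (hXi.sub (integrable_const θ)).pos_part
  have e : ∀ ω, elemScore θ (X ω) (Y ω) = 2 * (1 - θ) * X ω - 2 * max (X ω - θ) 0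
      - 2 * θ * (X ⁻¹' Set.Ioi θ).indicator (fun ω => Y ω - X ω) ω
      + 2 * (1 - θ) * (X ⁻¹' Set.Iio θ).indicator (fun ω => Y ω - X ω) ω := by
    intro ω
    simp only [elemScore, Set.indicator, Set.mem_preimage, Set.mem_Ioi, Set.mem_Iio]
    rcases lt_trichotomy (X ω) θ with h | h | h
    · rw [max_eq_right (by linarith)]
      rcases hYr ω with hy | hy <;> simp [h, hy, h.not_gt, h.ne] <;> ring
    · rcases hYr ω with hy | hy <;> simp [h, hy] <;> ring
    · rw [max_eq_left (by linarith)]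
      rcases hYr ω with hy | hy <;> simp [h, hy, h.not_gt, h.ne'] <;> ring
  have i1 := (hYi.sub hXi).indicator (hX (measurableSet_Ioi (a := θ)))
  have i2 := (hYi.sub hXi).indicator (hX (measurableSet_Iio (a := θ)))
  simp_rw [e]
  rw [integral_add, integral_sub, integral_sub]
  · simp only [integral_const_mul]
    rw [aux_cal μ X Y hX hYi hXi hcal _ measurableSet_Ioi,
      aux_cal μ X Y hX hYi hXi hcal _ measurableSet_Iio]
    ring
  · exact hXi.const_mul _
  · exact hM.const_mul _
  · exact (hXi.const_mul _).sub (hM.const_mul _)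
  · exact i1.const_mul _
  · exact ((hXi.const_mul _).sub (hM.const_mul _)).sub (i1.const_mul _)
  · exact i2.const_mul _

/-- piecewise linear interpolation with `n` pieces -/
noncomputable def auxI (φ : ℝ → ℝ) (n : ℕ) (x : ℝ) : ℝ :=
  φ 0 + ∑ i ∈ Finset.range n, (n * (φ ((i + 1 : ℕ) / n) - φ (i / n))) *
    (max (x - i / n) 0 - max (x - (i + 1 : ℕ) / n) 0)

lemma auxI_sum (φ : ℝ → ℝ) (n : ℕ) (hn : 0 < n) (x : ℝ) (k : ℕ) (hk : (k:ℝ) / n ≤ x) :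
    ∑ i ∈ Finset.range k, (n * (φ ((i + 1 : ℕ) / n) - φ (i / n))) *
    (max (x - i / n) 0 - max (x - (i + 1 : ℕ) / n) 0) = φ (k / n) - φ 0 := by
  have hn' : (0:ℝ) < n := by exact_mod_cast hn
  induction k with
  | zero => simp
  | succ k ih =>
    have h1 : (k:ℝ) / n ≤ (k + 1 : ℕ) / n := by gcongr; simp
    rw [Finset.sum_range_succ, ih (h1.trans hk), max_eq_left (by linarith),
      max_eq_left (by linarith)]
    have : (x - (k:ℝ) / n) - (x - (k + 1 : ℕ) / n) = 1 / n := by push_cast; field_simp; ring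
    rw [this]; field_simp; ring

lemma auxI_node (φ : ℝ → ℝ) (n : ℕ) (hn : 0 < n) (x : ℝ) (k : ℕ) (hkn : k < n)
    (hk : (k:ℝ) / n ≤ x) (hk' : x ≤ (k + 1 : ℕ) / n) :
    auxI φ n x = φ (k / n) + (n * x - k) * (φ ((k + 1 : ℕ) / n) - φ (k / n)) := by
  have hn' : (0:ℝ) < n := by exact_mod_cast hn
  rw [auxI, ← Finset.sum_range_add_sum_Ico _ (Nat.succ_le_of_lt hkn), Finset.sum_range_succ,
    auxI_sum φ n hn x k hk, Finset.sum_eq_zero]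
  · rw [max_eq_left (by linarith), max_eq_right (by linarith)]
    have : (n:ℝ) * x - k = n * (x - k / n) := by field_simp
    rw [this]; ring
  · intro i hi
    have h1 : ((k + 1 : ℕ) : ℝ) / n ≤ i / n := by
      gcongr; exact (Finset.mem_Ico.1 hi).1
    have h2 : (i:ℝ) / n ≤ (i + 1 : ℕ) / n := by gcongr; simp
    rw [max_eq_right (by linarith), max_eq_right (by linarith)]; simp

lemma auxI_one (φ : ℝ → ℝ) (n : ℕ) (hn : 0 < n) : auxI φ n 1 = φ 1 := by
  have hn' : (n:ℝ) ≠ 0 := by positivity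
  rw [auxI, auxI_sum φ n hn 1 n (by rw [div_self hn'])]
  rw [div_self hn']; ring

lemma auxI_floor (φ : ℝ → ℝ) (n : ℕ) (hn : 0 < n) (x : ℝ) (h0 : 0 ≤ x) (h1 : x < 1) :
    ⌊n * x⌋₊ < n ∧ 0 ≤ n * x - ⌊n * x⌋₊ ∧ n * x - ⌊n * x⌋₊ ≤ 1 ∧
    auxI φ n x = φ (⌊n * x⌋₊ / n) + (n * x - ⌊n * x⌋₊) *
      (φ ((⌊n * x⌋₊ + 1 : ℕ) / n) - φ (⌊n * x⌋₊ / n)) := by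
  have hn' : (0:ℝ) < n := by exact_mod_cast hn
  have a1 : (⌊n * x⌋₊ : ℝ) ≤ n * x := Nat.floor_le (by positivity)
  have a2 : n * x < ⌊n * x⌋₊ + 1 := Nat.lt_floor_add_one _
  have a3 : ⌊n * x⌋₊ < n := by
    have : (⌊n * x⌋₊ : ℝ) < n := by nlinarith
    exact_mod_cast this
  refine ⟨a3, by linarith, by linarith, auxI_node φ n hn x _ a3 ?_ ?_⟩
  · rw [div_le_iff₀ hn']; linarith
  · rw [le_div_iff₀ hn']; push_cast; linarith

lemma aux_mid (φ : ℝ → ℝ) (hφ : ConvexOn ℝ (Set.Icc 0 1) φ) (x y : ℝ)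
    (hx : x ∈ Set.Icc (0:ℝ) 1) (hy : y ∈ Set.Icc (0:ℝ) 1) :
    φ ((1/2:ℝ) • x + (1/2:ℝ) • y) ≤ (1/2:ℝ) • φ x + (1/2:ℝ) • φ y :=
  hφ.2 hx hy (by norm_num) (by norm_num) (by norm_num)

lemma aux_bdd (φ : ℝ → ℝ) (hφ : ConvexOn ℝ (Set.Icc 0 1) φ) :
    ∃ B, ∀ x ∈ Set.Icc (0:ℝ) 1, |φ x| ≤ B := by
  have up : ∀ x ∈ Set.Icc (0:ℝ) 1, φ x ≤ max (φ 0) (φ 1) := fun x hx =>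
    hφ.le_max_of_mem_Icc (by simp) (by simp) hx
  refine ⟨max (φ 0) (φ 1) + 2 * |max (φ 0) (φ 1)| + 2 * |φ (1/2)|, fun x hx => ?_⟩
  have h2 := up (1 - x) ⟨by linarith [hx.2], by linarith [hx.1]⟩
  have h3 := aux_mid φ hφ x (1 - x) hx ⟨by linarith [hx.2], by linarith [hx.1]⟩
  have h4 : (1/2:ℝ) • x + (1/2:ℝ) • (1 - x) = 1/2 := by simp only [smul_eq_mul]; ring
  rw [h4] at h3
  simp only [smul_eq_mul] at h3
  have := up x hx
  have := neg_abs_le (φ (1/2))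
  have := neg_abs_le (max (φ 0) (φ 1))
  have := abs_nonneg (φ (1/2))
  have := abs_nonneg (max (φ 0) (φ 1))
  rw [abs_le]; constructor <;> linarith

lemma auxI_bdd (φ : ℝ → ℝ) (B : ℝ) (hB : ∀ x ∈ Set.Icc (0:ℝ) 1, |φ x| ≤ B)
    (n : ℕ) (hn : 0 < n) (x : ℝ) (hx : x ∈ Set.Icc (0:ℝ) 1) : |auxI φ n x| ≤ B := by
  have hn' : (0:ℝ) < n := by exact_mod_cast hn
  rcases hx.2.lt_or_eq with h | h
  · obtain ⟨a, b, c, d⟩ := auxI_floor φ n hn x hx.1 h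
    rw [d]
    have a' : ((⌊n * x⌋₊ : ℕ) : ℝ) < n := by exact_mod_cast a
    have a'' : ((⌊n * x⌋₊ + 1 : ℕ) : ℝ) ≤ n := by exact_mod_cast a
    have e1 := abs_le.1 (hB (⌊n * x⌋₊ / n) ⟨by positivity, by rw [div_le_one hn']; exact a'.le⟩)
    have e2 := abs_le.1 (hB ((⌊n * x⌋₊ + 1 : ℕ) / n) ⟨by positivity, by rwa [div_le_one hn']⟩)
    generalize φ (⌊n * x⌋₊ / n) = u at *
    generalize φ ((⌊n * x⌋₊ + 1 : ℕ) / n) = v at *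
    generalize (n * x - ⌊n * x⌋₊ : ℝ) = t at *
    rw [abs_le]; constructor <;> nlinarith
  · rw [h, auxI_one φ n hn]; exact hB 1 (by simp)

lemma auxI_tendsto (φ : ℝ → ℝ) (hφ : ConvexOn ℝ (Set.Icc 0 1) φ)
    (x : ℝ) (hx : x ∈ Set.Icc (0:ℝ) 1) :
    Filter.Tendsto (fun n : ℕ => auxI φ (n + 1) x) Filter.atTop (nhds (φ x)) := by
  rcases hx.2.lt_or_eq with h | h
  swap
  · subst h
    simp only [auxI_one φ _ (Nat.succ_pos _)]; exact tendsto_const_nhds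
  rcases hx.1.lt_or_eq with h0 | h0
  swap
  · subst h0
    have : ∀ n : ℕ, auxI φ (n + 1) 0 = φ 0 := fun n => by
      have := (auxI_floor φ (n+1) (Nat.succ_pos _) 0 le_rfl (by norm_num)).2.2.2
      rw [this]; simp
    simp only [this]; exact tendsto_const_nhds
  have hc : ContinuousAt φ x := by
    have h1 : ConvexOn ℝ (Set.Ioo 0 1) φ := hφ.subset Set.Ioo_subset_Icc_self (convex_Ioo 0 1)
    exact (h1.continuousOn isOpen_Ioo).continuousAt (Ioo_mem_nhds h0 h)
  rw [Metric.continuousAt_iff] at hc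
  rw [Metric.tendsto_atTop]
  intro ε hε
  obtain ⟨δ, hδ, H⟩ := hc ε hε
  obtain ⟨N, hN⟩ := exists_nat_one_div_lt hδ
  refine ⟨N, fun n hn => ?_⟩
  obtain ⟨a, b, c, d⟩ := auxI_floor φ (n+1) (Nat.succ_pos _) x hx.1 h
  have hn' : (0:ℝ) < (n+1:ℕ) := by positivity
  have hn2 : 1 / ((n+1:ℕ):ℝ) < δ := by
    refine lt_of_le_of_lt ?_ hN
    push_cast; gcongr
  rw [div_lt_iff₀ hn'] at hn2
  rw [d]
  have e1 := H (x := ⌊(n+1:ℕ) * x⌋₊ / (n+1:ℕ)) (by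
    rw [Real.dist_eq, abs_lt]
    constructor
    · rw [lt_sub_iff_add_lt, lt_div_iff₀ hn']; nlinarith
    · rw [sub_lt_iff_lt_add, div_lt_iff₀ hn']; nlinarith)
  have e2 := H (x := (⌊(n+1:ℕ) * x⌋₊ + 1 : ℕ) / (n+1:ℕ)) (by
    rw [Real.dist_eq, abs_lt]
    constructor
    · rw [lt_sub_iff_add_lt, lt_div_iff₀ hn']
      rw [Nat.cast_add (⌊(n+1:ℕ) * x⌋₊) 1, Nat.cast_one]; nlinarith
    · rw [sub_lt_iff_lt_add, div_lt_iff₀ hn']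
      rw [Nat.cast_add (⌊(n+1:ℕ) * x⌋₊) 1, Nat.cast_one]; nlinarith)
  rw [Real.dist_eq, abs_lt] at *
  generalize φ (⌊(n+1:ℕ) * x⌋₊ / (n+1:ℕ)) = u at *
  generalize φ ((⌊(n+1:ℕ) * x⌋₊ + 1 : ℕ) / (n+1:ℕ)) = v at *
  generalize ((n+1:ℕ) * x - ⌊(n+1:ℕ) * x⌋₊ : ℝ) = t at *
  obtain ⟨p1, p2⟩ := e1
  obtain ⟨q1, q2⟩ := e2
  rcases b.lt_or_eq with b | b
  · constructor <;> nlinarith [mul_lt_mul_of_pos_left q1 b, mul_lt_mul_of_pos_left q2 b,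
      mul_le_mul_of_nonneg_left p1.le (sub_nonneg.2 c), mul_le_mul_of_nonneg_left p2.le (sub_nonneg.2 c)]
  · rw [← b]; constructor <;> linarith

lemma aux_abel (s D : ℕ → ℝ) (n : ℕ) (hs : ∀ i, i + 1 < n → s i ≤ s (i + 1))
    (hD : ∀ i, 0 ≤ D i) (h0 : D 0 = 0) (hn : D n = 0) :
    0 ≤ ∑ i ∈ Finset.range n, s i * (D i - D (i + 1)) := by
  have key : ∀ m, m ≤ n → 0 ≤ ∑ i ∈ Finset.range m, s i * (D i - D (i + 1)) + s m * D m := by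
    intro m
    induction m with
    | zero => intro _; simp [h0]
    | succ m ih =>
      intro hm
      have := ih (by omega)
      rw [Finset.sum_range_succ]
      rcases hm.lt_or_eq with h | h
      · nlinarith [mul_nonneg (sub_nonneg.2 (hs m h)) (hD (m + 1))]
      · rw [h, hn]; nlinarith
  have := key n le_rfl
  rw [hn] at this; linarith

lemma aux_convex {Ω : Type*} [MeasurableSpace Ω] (μ : Measure Ω) [IsProbabilityMeasure μ]
    (X₁ X₂ : Ω → ℝ) (hX₁ : Measurable X₁) (hX₂ : Measurable X₂)
    (hX₁r : ∀ ω, X₁ ω ∈ Set.Icc (0:ℝ) 1) (hX₂r : ∀ ω, X₂ ω ∈ Set.Icc (0:ℝ) 1)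
    (hE : ∫ ω, X₁ ω ∂μ = ∫ ω, X₂ ω ∂μ)
    (h : ∀ θ ∈ Set.Ioo (0:ℝ) 1, ∫ ω, max (X₂ ω - θ) 0 ∂μ ≤ ∫ ω, max (X₁ ω - θ) 0 ∂μ)
    (φ : ℝ → ℝ) (hφ : ConvexOn ℝ (Set.Icc 0 1) φ) :
    ∫ ω, φ (X₂ ω) ∂μ ≤ ∫ ω, φ (X₁ ω) ∂μ := by
  obtain ⟨B, hB⟩ := aux_bdd φ hφ
  have meas : ∀ n, Measurable (auxI φ n) := fun n => by unfold auxI; fun_prop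
  have lim : ∀ X : Ω → ℝ, Measurable X → (∀ ω, X ω ∈ Set.Icc (0:ℝ) 1) →
      Filter.Tendsto (fun n : ℕ => ∫ ω, auxI φ (n+1) (X ω) ∂μ) Filter.atTop
        (nhds (∫ ω, φ (X ω) ∂μ)) := fun X hX hXr =>
    tendsto_integral_of_dominated_convergence (fun _ => B)
      (fun n => ((meas _).comp hX).aestronglyMeasurable) (integrable_const _)
      (fun n => Filter.Eventually.of_forall fun ω =>
        auxI_bdd φ B hB _ (Nat.succ_pos _) _ (hXr ω))
      (Filter.Eventually.of_forall fun ω => auxI_tendsto φ hφ _ (hXr ω))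
  have hI : ∀ X : Ω → ℝ, Measurable X → (∀ ω, X ω ∈ Set.Icc (0:ℝ) 1) → ∀ θ : ℝ,
      Integrable (fun ω => max (X ω - θ) 0) μ := fun X hX hXr θ =>
    ((aux_int μ X hX hXr).sub (integrable_const θ)).pos_part
  have ex : ∀ X : Ω → ℝ, Measurable X → (∀ ω, X ω ∈ Set.Icc (0:ℝ) 1) → ∀ n : ℕ,
      ∫ ω, auxI φ n (X ω) ∂μ = φ 0 + ∑ i ∈ Finset.range n,
        (n * (φ ((i + 1 : ℕ) / n) - φ (i / n))) *
        (∫ ω, max (X ω - i / n) 0 ∂μ - ∫ ω, max (X ω - (i + 1 : ℕ) / n) 0 ∂μ) := by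
    intro X hX hXr n
    unfold auxI
    rw [integral_add (integrable_const _), integral_finsetSum]
    · simp only [integral_const_mul]
      congr 1
      · simp
      · refine Finset.sum_congr rfl fun i _ => ?_
        rw [integral_sub (hI X hX hXr _) (hI X hX hXr _)]
    · exact fun i _ => ((hI X hX hXr _).sub (hI X hX hXr _)).const_mul _
    · exact integrable_finsetSum _ fun i _ =>
        ((hI X hX hXr _).sub (hI X hX hXr _)).const_mul _
  refine le_of_tendsto_of_tendsto' (lim X₂ hX₂ hX₂r) (lim X₁ hX₁ hX₁r) fun n => ?_
  rw [ex X₂ hX₂ hX₂r, ex X₁ hX₁ hX₁r, ← sub_nonneg, add_sub_add_left_eq_sub,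
    ← Finset.sum_sub_distrib]
  have hn' : (0:ℝ) < (n+1:ℕ) := by positivity
  have big : ∀ X : Ω → ℝ, (∀ ω, X ω ∈ Set.Icc (0:ℝ) 1) → ∀ θ : ℝ, 1 ≤ θ →
      ∫ ω, max (X ω - θ) 0 ∂μ = 0 := by
    intro X hXr θ hθ
    have : ∀ ω, max (X ω - θ) 0 = 0 := fun ω => max_eq_right (by linarith [(hXr ω).2])
    simp [this]
  have zer : ∀ X : Ω → ℝ, (∀ ω, X ω ∈ Set.Icc (0:ℝ) 1) →
      ∫ ω, max (X ω - 0) 0 ∂μ = ∫ ω, X ω ∂μ := by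
    intro X hXr
    have : ∀ ω, max (X ω - 0) 0 = X ω := fun ω => by
      rw [sub_zero]; exact max_eq_left (hXr ω).1
    simp only [this]
  have := aux_abel (fun i => ((n+1:ℕ):ℝ) * (φ ((i + 1 : ℕ) / (n+1:ℕ)) - φ (i / (n+1:ℕ))))
    (fun i => ∫ ω, max (X₁ ω - i / (n+1:ℕ)) 0 ∂μ - ∫ ω, max (X₂ ω - i / (n+1:ℕ)) 0 ∂μ) (n+1)
    ?_ ?_ ?_ ?_
  · refine this.trans_eq (Finset.sum_congr rfl fun i _ => ?_)
    ring
  · intro i hi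
    have hi' : ((i + 1 + 1 : ℕ):ℝ) ≤ (n+1:ℕ) := by exact_mod_cast hi
    have hi2 : (i:ℝ) ≤ (n+1:ℕ) := by push_cast at hi' ⊢; linarith
    have := aux_mid φ hφ (i / (n+1:ℕ)) ((i + 1 + 1 : ℕ) / (n+1:ℕ))
      ⟨by positivity, by rwa [div_le_one hn']⟩ ⟨by positivity, by rwa [div_le_one hn']⟩
    have e : (1/2:ℝ) • ((i:ℝ) / (n+1:ℕ)) + (1/2:ℝ) • (((i + 1 + 1 : ℕ):ℝ) / (n+1:ℕ))
        = (i + 1 : ℕ) / (n+1:ℕ) := by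
      simp only [smul_eq_mul]; push_cast; ring
    rw [e] at this
    simp only [smul_eq_mul] at this
    exact mul_le_mul_of_nonneg_left (by linarith) hn'.le
  · intro i
    rcases Nat.eq_zero_or_pos i with rfl | hi
    · simp only [Nat.cast_zero, zero_div]
      rw [zer X₁ hX₁r, zer X₂ hX₂r, hE, sub_self]
    · rcases lt_or_ge ((i:ℝ) / (n+1:ℕ)) 1 with h1 | h1
      · exact sub_nonneg.2 (h _ ⟨by positivity, h1⟩)
      · simp only [big X₁ hX₁r _ h1, big X₂ hX₂r _ h1, sub_self, le_refl]
  · simp only [Nat.cast_zero, zero_div]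
    rw [zer X₁ hX₁r, zer X₂ hX₂r, hE, sub_self]
  · have h1 : (1:ℝ) ≤ ((n+1:ℕ):ℝ) / (n+1:ℕ) := by rw [div_self hn'.ne']
    simp only [big X₁ hX₁r _ h1, big X₂ hX₂r _ h1, sub_self]

/-- For calibrated probability forecasts `X₁, X₂` of the binary outcome `Y` with
`0 < ℙ(Y=0) < 1`: `X₁` is sharper than `X₂` (greater in convex order, with strict
inequality for some convex function) if and only if `X₁` dominates `X₂` in the Murphy
sense (pointwise smaller expected elementary scores, strictly smaller for some `θ`). -/
theorem sharper_iff_murphy_dominance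
    {Ω : Type*} [MeasurableSpace Ω] (μ : Measure Ω) [IsProbabilityMeasure μ]
    (X₁ X₂ Y : Ω → ℝ) (hX₁ : Measurable X₁) (hX₂ : Measurable X₂) (hY : Measurable Y)
    (hX₁r : ∀ ω, X₁ ω ∈ Set.Icc (0:ℝ) 1) (hX₂r : ∀ ω, X₂ ω ∈ Set.Icc (0:ℝ) 1)
    (hYr : ∀ ω, Y ω = 0 ∨ Y ω = 1)
    (hY0 : 0 < μ {ω | Y ω = 0}) (hY0' : μ {ω | Y ω = 0} < 1)
    (hcal₁ : μ[Y | MeasurableSpace.comap X₁ inferInstance] =ᵐ[μ] X₁)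
    (hcal₂ : μ[Y | MeasurableSpace.comap X₂ inferInstance] =ᵐ[μ] X₂) :
    ((∀ φ : ℝ → ℝ, ConvexOn ℝ (Set.Icc 0 1) φ →
        (∫ ω, φ (X₂ ω) ∂μ) ≤ ∫ ω, φ (X₁ ω) ∂μ)
      ∧ (∃ φ : ℝ → ℝ, ConvexOn ℝ (Set.Icc 0 1) φ ∧
          (∫ ω, φ (X₂ ω) ∂μ) < ∫ ω, φ (X₁ ω) ∂μ))
    ↔ ((∀ θ ∈ Set.Ioo (0:ℝ) 1,
          (∫ ω, elemScore θ (X₁ ω) (Y ω) ∂μ) ≤ ∫ ω, elemScore θ (X₂ ω) (Y ω) ∂μ)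
        ∧ (∃ θ ∈ Set.Ioo (0:ℝ) 1,
            (∫ ω, elemScore θ (X₁ ω) (Y ω) ∂μ) < ∫ ω, elemScore θ (X₂ ω) (Y ω) ∂μ)) := by
  have m : ∀ X : Ω → ℝ, Measurable X → (∀ ω, X ω ∈ Set.Icc (0:ℝ) 1) →
      μ[Y | MeasurableSpace.comap X inferInstance] =ᵐ[μ] X →
      ∫ ω, X ω ∂μ = ∫ ω, Y ω ∂μ := by
    intro X hX hXr hcal
    rw [← integral_condExp hX.comap_le (f := Y)]
    exact (integral_congr_ae hcal).symm
  have hE : ∫ ω, X₁ ω ∂μ = ∫ ω, X₂ ω ∂μ :=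
    (m X₁ hX₁ hX₁r hcal₁).trans (m X₂ hX₂ hX₂r hcal₂).symm
  have s1 := aux_score μ X₁ Y hX₁ hY hX₁r hYr hcal₁
  have s2 := aux_score μ X₂ Y hX₂ hY hX₂r hYr hcal₂
  have hc : ∀ θ : ℝ, ConvexOn ℝ (Set.Icc (0:ℝ) 1) (fun x => max (x - θ) 0) := fun θ =>
    ((convexOn_id (convex_Icc 0 1)).sub (concaveOn_const θ (convex_Icc 0 1))).sup
      (convexOn_const 0 (convex_Icc 0 1))
  simp only [s1, s2, hE]
  constructor
  · rintro ⟨h1, φ, hφ, h2⟩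
    refine ⟨fun θ _ => by linarith [h1 _ (hc θ)], ?_⟩
    by_contra! H
    have := aux_convex μ X₂ X₁ hX₂ hX₁ hX₂r hX₁r hE.symm
      (fun θ hθ => by linarith [H θ hθ]) φ hφ
    linarith
  · rintro ⟨h1, θ, hθ, h2⟩
    exact ⟨aux_convex μ X₁ X₂ hX₁ hX₂ hX₁r hX₂r hE (fun θ hθ => by linarith [h1 θ hθ]),
      _, hc θ, by linarith⟩
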